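/- Fix μ > 0 and sequences x^ℓ ∈ E, z^ℓ ∈ ℝ^m, d^ℓ ∈ E (ℓ ∈ ℕ) with g_i(x^ℓ) > 0 and z^ℓ_i > 0 for all ℓ, i. Assume: (a) there are constants C_g, C_G, C_z > 0 with ‖∇g_i(x^ℓ)‖ ≤ C_g, ‖Hess g_i(x^ℓ)‖_op ≤ C_G and z^ℓ_i ≤ C_z for all ℓ, i; (b) there are ε̄ > 0 and δ₀ > 0 such that g_i(x^ℓ + v) ≥ ε̄ for all ℓ, i and all v ∈ E with ‖v‖ ≤ δ₀; (c) there are β₁, δ₁, β₂, δ₂ > 0 such that |⟨∇g_i(x^ℓ+tv) − ∇g_i(x^ℓ), v⟩| ≤ β₁ t‖v‖² whenever t ≥ 0 and t‖v‖ ≤ δ₁, and |⟨(Hess h(x^ℓ+tv) − Hess h(x^ℓ))v, v⟩| ≤ β₂ t‖v‖³ whenever t ≥ 0 and t‖v‖ ≤ δ₂, for every h ∈ {f, g_1,…,g_m}, every ℓ and every i; and (d) lim_{ℓ→∞} max_{1≤i≤m} |z^ℓ_i − μ/g_i(x^ℓ)| = 0. Then for every γ > 0 there exist δ' > 0 and K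 ∈ ℕ such that for all ℓ ≥ K with ‖d^ℓ‖ ≤ δ', |pred_{x^ℓ,z^ℓ,μ}(d^ℓ) − ared_{x^ℓ,μ}(d^ℓ)| ≤ γ ‖d^ℓ‖². -/

import Mathlib

open Filter Topology
open scoped RealInnerProductSpace BigOperators

noncomputable section

variable {E : Type*} [NormedAddCommGroup E] [InnerProductSpace ℝ E] [FiniteDimensional ℝ E]

/-- A forcing function: continuous on `[0,∞)`, nonnegative there, vanishing exactly at `0`. -/
def IsForcing (ρ : ℝ → ℝ) : Prop :=
  ContinuousOn ρ (Set.Ici 0) ∧ (∀ t, 0 ≤ t → 0 ≤ ρ t) ∧ ∀ t, 0 ≤ t → (ρ t = 0 ↔ t = 0)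

/-- The Hessian of `h` at `x`, i.e. the derivative of the gradient field of `h` at `x`. -/
def Hess (h : E → ℝ) (x : E) : E →L[ℝ] E := fderiv ℝ (gradient h) x

/-- Gradient of the Lagrangian `L(x,z) = f(x) - ∑ i, z i * g i x` with respect to `x`. -/
def gradL {m : ℕ} (f : E → ℝ) (g : Fin m → E → ℝ) (x : E) (z : Fin m → ℝ) : E :=
  gradient f x - ∑ i, z i • gradient (g i) x

/-- Hessian of the Lagrangian with respect to `x`. -/
def hessL {m : ℕ} (f : E → ℝ) (g : Fin m → E → ℝ) (x : E) (z : Fin m → ℝ) : E →L[ℝ] E :=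
  Hess f x - ∑ i, z i • Hess (g i) x

/-- The condensed primal-dual operator `H(x,z)`,
`H(x,z) v = Hess_x L(x,z) v + ∑ i (z i / g i x) ⟪∇g i x, v⟫ ∇g i x`. -/
def Hxz {m : ℕ} (f : E → ℝ) (g : Fin m → E → ℝ) (x : E) (z : Fin m → ℝ) : E →L[ℝ] E :=
  hessL f g x z +
    ∑ i, (z i / g i x) • ((innerSL ℝ (gradient (g i) x)).smulRight (gradient (g i) x))

/-- Smallest Rayleigh-quotient value of `A` over the unit sphere. -/
def lamMin (A : E →L[ℝ] E) : ℝ := sInf ((fun v => ⟪A v, v⟫) '' {v : E | ‖v‖ = 1})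

/-- The log-barrier merit function `φ_μ`. -/
def barrierPhi {m : ℕ} (μ : ℝ) (f : E → ℝ) (g : Fin m → E → ℝ) (x : E) : ℝ :=
  f x - μ * ∑ i, Real.log (g i x)

/-- The barrier gradient `q_μ(x) = ∇f(x) - μ ∑ i ∇g i (x) / g i x`. -/
def qmu {m : ℕ} (μ : ℝ) (f : E → ℝ) (g : Fin m → E → ℝ) (x : E) : E :=
  gradient f x - μ • ∑ i, (g i x)⁻¹ • gradient (g i) x

/-- Trust-region model `m_{x,z,μ}(d)`. -/
def trModel {m : ℕ} (μ : ℝ) (f : E → ℝ) (g : Fin m → E → ℝ) (x : E) (z : Fin m → ℝ)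
    (d : E) : ℝ :=
  (1/2) * ⟪Hxz f g x z d, d⟫ + ⟪qmu μ f g x, d⟫

/-- Predicted reduction of the step `d`. -/
def predRed {m : ℕ} (μ : ℝ) (f : E → ℝ) (g : Fin m → E → ℝ) (x : E) (z : Fin m → ℝ)
    (d : E) : ℝ :=
  - trModel μ f g x z d

/-- Actual reduction of the step `d`. -/
def aredRed {m : ℕ} (μ : ℝ) (f : E → ℝ) (g : Fin m → E → ℝ) (x : E) (d : E) : ℝ :=
  barrierPhi μ f g x - barrierPhi μ f g (x + d)


theorem inner_gradient_eq_fderiv (h : E → ℝ) (y v : E) :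
    ⟪gradient h y, v⟫ = fderiv ℝ h y v := by
  simp [gradient]

theorem differentiable_gradient {h : E → ℝ} (hh : ContDiff ℝ 2 h) :
    Differentiable ℝ (gradient h) := by
  have h1 : Differentiable ℝ (fderiv ℝ h) :=
    (hh.fderiv_right (m := 1) (by norm_num)).differentiable (by norm_num)
  exact (InnerProductSpace.toDual ℝ E).symm.toContinuousLinearEquiv.differentiable.comp h1

/-- Second-order Taylor estimate from a bound on the variation of the Hessian quadratic form
along the segment from `x` to `x + v`. -/
theorem abs_taylor_two_le_of_hess {h : E → ℝ} (hh : ContDiff ℝ 2 h) (x v : E) {C : ℝ}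
    (hC : ∀ t ∈ Set.Icc (0 : ℝ) 1, |⟪(Hess h (x + t • v) - Hess h x) v, v⟫| ≤ C) :
    |h (x + v) - h x - ⟪gradient h x, v⟫ - 1 / 2 * ⟪Hess h x v, v⟫| ≤ C := by
  have hline : ∀ t : ℝ, HasDerivAt (fun t : ℝ => x + t • v) v t := fun t => by
    simpa using ((hasDerivAt_id t).smul_const v).const_add x
  have hfst : ∀ t : ℝ, HasDerivAt (fun t : ℝ => h (x + t • v)) ⟪gradient h (x + t • v), v⟫ t := by
    intro t
    rw [inner_gradient_eq_fderiv]
    exact ((hh.differentiable (by norm_num) _).hasFDerivAt).comp_hasDerivAt t (hline t)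
  have hsnd : ∀ t : ℝ, HasDerivAt (fun t : ℝ => ⟪gradient h (x + t • v), v⟫)
      ⟪Hess h (x + t • v) v, v⟫ t := by
    intro t
    have h1 : HasDerivAt (fun t : ℝ => gradient h (x + t • v)) (Hess h (x + t • v) v) t :=
      ((differentiable_gradient hh _).hasFDerivAt).comp_hasDerivAt t (hline t)
    simpa using h1.inner ℝ (hasDerivAt_const t v)
  have hC0 : 0 ≤ C := (abs_nonneg _).trans (hC 0 (by simp))
  have hu : ∀ t ∈ Set.Icc (0 : ℝ) 1,
      |⟪gradient h (x + t • v), v⟫ - ⟪gradient h x, v⟫ - t * ⟪Hess h x v, v⟫| ≤ C := by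
    intro t ht
    have key := norm_image_sub_le_of_norm_deriv_le_segment' (a := 0) (b := 1)
      (f := fun t : ℝ => ⟪gradient h (x + t • v), v⟫ - t * ⟪Hess h x v, v⟫)
      (f' := fun t : ℝ => ⟪Hess h (x + t • v) v, v⟫ - 1 * ⟪Hess h x v, v⟫) (C := C)
      (fun s _ => ((hsnd s).sub ((hasDerivAt_id s).mul_const _)).hasDerivWithinAt)
      (fun s hs => by
        have := hC s ⟨hs.1, hs.2.le⟩
        simpa [inner_sub_left] using this) t ht
    simp only [zero_smul, add_zero, zero_mul, sub_zero, Real.norm_eq_abs] at key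
    have h2 : C * t ≤ C := by nlinarith [ht.2]
    refine le_trans (le_of_eq ?_) (key.trans h2)
    congr 1; ring
  have key := norm_image_sub_le_of_norm_deriv_le_segment_01' (C := C)
    (f := fun t : ℝ => h (x + t • v) - t * ⟪gradient h x, v⟫ - t ^ 2 * (1 / 2 * ⟪Hess h x v, v⟫))
    (f' := fun t : ℝ => ⟪gradient h (x + t • v), v⟫ - 1 * ⟪gradient h x, v⟫
      - (2 * t) * (1 / 2 * ⟪Hess h x v, v⟫))
    (fun s _ => by
      have h3 : HasDerivAt (fun t : ℝ => t ^ 2) (2 * s) s := by simpa using hasDerivAt_pow 2 s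
      exact (((hfst s).sub ((hasDerivAt_id s).mul_const _)).sub
        (h3.mul_const _)).hasDerivWithinAt)
    (fun s hs => by
      rw [Real.norm_eq_abs]
      refine le_trans (le_of_eq ?_) (hu s ⟨hs.1, hs.2.le⟩)
      congr 1; ring)
  simp only [one_smul, zero_smul, add_zero, Real.norm_eq_abs] at key
  refine le_trans (le_of_eq ?_) key
  congr 1; ring

theorem abs_log_one_add_sub_le {r : ℝ} (hr : |r| ≤ 1 / 2) :
    |Real.log (1 + r) - r + 1 / 2 * r ^ 2| ≤ 2 * |r| ^ 3 := by
  have h1 := Real.abs_log_sub_add_sum_range_le (x := -r) (by rw [abs_neg]; linarith) 2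
  simp only [Finset.sum_range_succ, Finset.sum_range_zero, abs_neg, sub_neg_eq_add] at h1
  have h2 : |r| ^ 3 / (1 - |r|) ≤ 2 * |r| ^ 3 := by
    rw [div_le_iff₀ (by linarith)]
    nlinarith [pow_nonneg (abs_nonneg r) 3]
  refine le_trans (le_of_eq ?_) (h1.trans h2)
  congr 1; push_cast; ring

/-- Second-order expansion of `log b` around `a`, with `b` given to third order in `s` by
`a + G + Q / 2`. -/
theorem abs_log_taylor_two_le {ε a b G Q s C₁ C₂ β : ℝ} (hε : 0 < ε) (ha : ε ≤ a)
    (hs0 : 0 ≤ s) (hs1 : s ≤ 1) (hC₁ : 0 ≤ C₁) (hC₂ : 0 ≤ C₂) (hβ : 0 ≤ β)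
    (hs : (C₁ + C₂ / 2 + β) / ε * s ≤ 1 / 2)
    (hG : |G| ≤ C₁ * s) (hQ : |Q| ≤ C₂ * s ^ 2) (hb : |b - a - G - 1 / 2 * Q| ≤ β * s ^ 3) :
    |Real.log b - Real.log a - a⁻¹ * G - 1 / 2 * (a⁻¹ * Q) + 1 / 2 * (a⁻¹ * G) ^ 2| ≤
      (2 * ((C₁ + C₂ / 2 + β) / ε) ^ 3 + ((C₁ + C₂ / 2 + β) / ε) ^ 2 + β / ε) * s ^ 3 := by
  have ha0 : 0 < a := hε.trans_le ha
  set c : ℝ := (C₁ + C₂ / 2 + β) / ε with hc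
  have hc0 : 0 ≤ c := by positivity
  have hs32 : s ^ 3 ≤ s ^ 2 := pow_le_pow_of_le_one hs0 hs1 (by norm_num)
  have hs21 : s ^ 2 ≤ s := by nlinarith
  have hdiv : ∀ y B : ℝ, |y| ≤ B → |a⁻¹ * y| ≤ B / ε := fun y B hy => by
    rw [abs_mul, abs_of_pos (inv_pos.2 ha0), inv_mul_eq_div]
    exact div_le_div₀ ((abs_nonneg _).trans hy) hy hε ha
  have hcε : ∀ k : ℝ, (C₁ + C₂ / 2 + β) * k / ε = c * k := fun k => by rw [hc]; ring
  set r : ℝ := a⁻¹ * (b - a) with hr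
  have hr1 : |r| ≤ c * s := by
    rw [← hcε]
    refine hdiv _ _ ?_
    have h1 := abs_le.1 hG
    have h2 := abs_le.1 hQ
    have h3 := abs_le.1 hb
    have h4 : C₂ * s ^ 2 ≤ C₂ * s := by gcongr
    have h5 : β * s ^ 3 ≤ β * s := by gcongr; linarith
    rw [abs_le]
    constructor <;> nlinarith
  have hr2 : |r - a⁻¹ * G| ≤ c * s ^ 2 := by
    rw [← hcε, hr, ← mul_sub]
    refine hdiv _ _ ?_
    have h2 := abs_le.1 hQ
    have h3 := abs_le.1 hb
    have h5 : β * s ^ 3 ≤ β * s ^ 2 := by gcongr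
    have h6 : 0 ≤ C₁ * s ^ 2 := by positivity
    rw [abs_le]
    constructor <;> nlinarith
  have hGa : |a⁻¹ * G| ≤ c * s := by
    rw [← hcε]
    refine hdiv _ _ (hG.trans ?_)
    gcongr
    linarith
  have hr3 : |r - a⁻¹ * G - 1 / 2 * (a⁻¹ * Q)| ≤ β / ε * s ^ 3 := by
    have := hdiv _ _ hb
    rw [mul_div_right_comm] at this
    refine le_trans (le_of_eq ?_) this
    congr 1; rw [hr]; ring
  have hsq : |r ^ 2 - (a⁻¹ * G) ^ 2| ≤ 2 * c ^ 2 * s ^ 3 := by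
    have h1 : |r + a⁻¹ * G| ≤ 2 * (c * s) := (abs_add_le _ _).trans (by linarith)
    calc |r ^ 2 - (a⁻¹ * G) ^ 2| = |r - a⁻¹ * G| * |r + a⁻¹ * G| := by
          rw [← abs_mul]; congr 1; ring
      _ ≤ (c * s ^ 2) * (2 * (c * s)) := by gcongr
      _ = 2 * c ^ 2 * s ^ 3 := by ring
  have hrh : |r| ≤ 1 / 2 := hr1.trans hs
  have hlog : |Real.log (1 + r) - r + 1 / 2 * r ^ 2| ≤ 2 * c ^ 3 * s ^ 3 := by
    refine (abs_log_one_add_sub_le hrh).trans ?_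
    rw [mul_assoc, ← mul_pow]
    gcongr
  have hb0 : 0 < b := by
    have h1 := (abs_le.1 hrh).1
    have h2 : b = a * (1 + r) := by rw [hr]; field_simp; ring
    rw [h2]
    exact mul_pos ha0 (by linarith)
  have hlogb : Real.log b - Real.log a = Real.log (1 + r) := by
    rw [← Real.log_div hb0.ne' ha0.ne']
    congr 1; rw [hr]; field_simp; ring
  rw [hlogb]
  have h1 := abs_le.1 hlog
  have h2 := abs_le.1 hsq
  have h3 := abs_le.1 hr3
  rw [abs_le]
  constructor <;> linarith

/-- The gap between predicted and actual reduction splits into Taylor remainders of the objective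
and of the logarithms of the constraints, and a term measuring the dual residual. -/
theorem predRed_sub_aredRed_eq {m : ℕ} (μ : ℝ) (f : E → ℝ) (g : Fin m → E → ℝ) (x : E)
    (z : Fin m → ℝ) (d : E) :
    predRed μ f g x z d - aredRed μ f g x d =
      (f (x + d) - f x - ⟪gradient f x, d⟫ - 1 / 2 * ⟪Hess f x d, d⟫)
      - μ * ∑ i, (Real.log (g i (x + d)) - Real.log (g i x) - (g i x)⁻¹ * ⟪gradient (g i) x, d⟫
          - 1 / 2 * ((g i x)⁻¹ * ⟪Hess (g i) x d, d⟫)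
          + 1 / 2 * ((g i x)⁻¹ * ⟪gradient (g i) x, d⟫) ^ 2)
      + ∑ i, (z i - μ / g i x) *
          (1 / 2 * (⟪Hess (g i) x d, d⟫ - (g i x)⁻¹ * ⟪gradient (g i) x, d⟫ ^ 2)) := by
  have h1 : ⟪Hxz f g x z d, d⟫ = ⟪Hess f x d, d⟫ - ∑ i, z i * ⟪Hess (g i) x d, d⟫
      + ∑ i, z i / g i x * (⟪gradient (g i) x, d⟫ * ⟪gradient (g i) x, d⟫) := by
    simp [Hxz, hessL, inner_add_left, inner_sub_left, sum_inner, real_inner_smul_left]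
  have h2 : ⟪qmu μ f g x, d⟫ = ⟪gradient f x, d⟫
      - μ * ∑ i, (g i x)⁻¹ * ⟪gradient (g i) x, d⟫ := by
    simp [qmu, inner_sub_left, sum_inner, real_inner_smul_left]
  have h3 : ∑ i, (Real.log (g i (x + d)) - Real.log (g i x) - (g i x)⁻¹ * ⟪gradient (g i) x, d⟫
          - 1 / 2 * ((g i x)⁻¹ * ⟪Hess (g i) x d, d⟫)
          + 1 / 2 * ((g i x)⁻¹ * ⟪gradient (g i) x, d⟫) ^ 2)
      = ∑ i, Real.log (g i (x + d)) - ∑ i, Real.log (g i x)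
        - ∑ i, (g i x)⁻¹ * ⟪gradient (g i) x, d⟫ - 1 / 2 * ∑ i, (g i x)⁻¹ * ⟪Hess (g i) x d, d⟫
        + 1 / 2 * ∑ i, ((g i x)⁻¹ * ⟪gradient (g i) x, d⟫) ^ 2 := by
    simp only [Finset.sum_sub_distrib, Finset.sum_add_distrib, Finset.mul_sum]
  have h4 : ∑ i, (z i - μ / g i x) *
        (1 / 2 * (⟪Hess (g i) x d, d⟫ - (g i x)⁻¹ * ⟪gradient (g i) x, d⟫ ^ 2))
      = 1 / 2 * ∑ i, z i * ⟪Hess (g i) x d, d⟫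
        - 1 / 2 * ∑ i, z i / g i x * (⟪gradient (g i) x, d⟫ * ⟪gradient (g i) x, d⟫)
        - μ * (1 / 2 * ∑ i, (g i x)⁻¹ * ⟪Hess (g i) x d, d⟫)
        + μ * (1 / 2 * ∑ i, ((g i x)⁻¹ * ⟪gradient (g i) x, d⟫) ^ 2) := by
    simp only [Finset.mul_sum, ← Finset.sum_sub_distrib, ← Finset.sum_add_distrib]
    refine Finset.sum_congr rfl fun i _ => ?_
    ring
  rw [h3, h4, predRed, trModel, aredRed, barrierPhi, barrierPhi, h1, h2]
  ring

/-- With dual convergence `z^ℓ_i − μ/g_i(x^ℓ) → 0`, the quadratic bound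
on the predicted/actual reduction gap can be made with an arbitrarily small constant. -/
theorem pred_ared_gap_small_constant
    {E : Type*} [NormedAddCommGroup E] [InnerProductSpace ℝ E] [FiniteDimensional ℝ E]
    [Nontrivial E] {m : ℕ} (hm : 1 ≤ m)
    (f : E → ℝ) (g : Fin m → E → ℝ)
    (hf : ContDiff ℝ 2 f) (hg : ∀ i, ContDiff ℝ 2 (g i))
    (μ : ℝ) (hμ : 0 < μ)
    (x : ℕ → E) (z : ℕ → Fin m → ℝ) (d : ℕ → E)
    (hgpos : ∀ ℓ i, 0 < g i (x ℓ)) (hzpos : ∀ ℓ i, 0 < z ℓ i)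
    -- (a) uniform bounds
    (Cg CG Cz : ℝ) (hCg : 0 < Cg) (hCG : 0 < CG) (hCz : 0 < Cz)
    (hgradb : ∀ ℓ i, ‖gradient (g i) (x ℓ)‖ ≤ Cg)
    (hhessb : ∀ ℓ i, ‖Hess (g i) (x ℓ)‖ ≤ CG)
    (hzb : ∀ ℓ i, z ℓ i ≤ Cz)
    -- (b) uniform strict feasibility in a neighborhood of the iterates
    (εb δ₀ : ℝ) (hεb : 0 < εb) (hδ₀ : 0 < δ₀)
    (hglow : ∀ ℓ i, ∀ v : E, ‖v‖ ≤ δ₀ → εb ≤ g i (x ℓ + v))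
    -- (c) radial Lipschitz bounds
    (β₁ δ₁ β₂ δ₂ : ℝ) (hβ₁ : 0 < β₁) (hδ₁ : 0 < δ₁) (hβ₂ : 0 < β₂) (hδ₂ : 0 < δ₂)
    (hrad1 : ∀ ℓ i (t : ℝ) (v : E), 0 ≤ t → t * ‖v‖ ≤ δ₁ →
      |⟪gradient (g i) (x ℓ + t • v) - gradient (g i) (x ℓ), v⟫| ≤ β₁ * t * ‖v‖ ^ 2)
    (hrad2f : ∀ ℓ (t : ℝ) (v : E), 0 ≤ t → t * ‖v‖ ≤ δ₂ →
      |⟪(Hess f (x ℓ + t • v) - Hess f (x ℓ)) v, v⟫| ≤ β₂ * t * ‖v‖ ^ 3)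
    (hrad2g : ∀ ℓ i (t : ℝ) (v : E), 0 ≤ t → t * ‖v‖ ≤ δ₂ →
      |⟪(Hess (g i) (x ℓ + t • v) - Hess (g i) (x ℓ)) v, v⟫| ≤ β₂ * t * ‖v‖ ^ 3)
    -- (d) dual convergence, componentwise
    (hzconv : ∀ i, Tendsto (fun ℓ => |z ℓ i - μ / g i (x ℓ)|) atTop (𝓝 0)) :
    ∀ γ > (0:ℝ), ∃ δ' > (0:ℝ), ∃ K : ℕ, ∀ ℓ ≥ K, ‖d ℓ‖ ≤ δ' →
      |predRed μ f g (x ℓ) (z ℓ) (d ℓ) - aredRed μ f g (x ℓ) (d ℓ)| ≤ γ * ‖d ℓ‖ ^ 2 := by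
  intro γ hγ
  have hβ : 0 ≤ β₂ := hβ₂.le
  set c : ℝ := (Cg + CG / 2 + β₂) / εb with hc
  have hc0 : 0 < c := by positivity
  set B : ℝ := 2 * c ^ 3 + c ^ 2 + β₂ / εb with hB
  have hB0 : 0 < B := by positivity
  set D : ℝ := 1 / 2 * (CG + εb⁻¹ * Cg ^ 2) with hD
  have hD0 : 0 < D := by positivity
  set M : ℝ := β₂ + μ * (m * B) with hM
  have hM0 : 0 < M := by positivity
  have hsum : Tendsto (fun ℓ => ∑ i, |z ℓ i - μ / g i (x ℓ)|) atTop (𝓝 0) := by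
    simpa using tendsto_finsetSum Finset.univ fun i _ => hzconv i
  obtain ⟨K, hK⟩ := eventually_atTop.1
    (hsum.eventually_le_const (show (0 : ℝ) < γ / 2 / D by positivity))
  refine ⟨min (min 1 δ₂) (min (1 / 2 / c) (γ / 2 / M)), by positivity, K, fun ℓ hℓ hd => ?_⟩
  simp only [le_min_iff] at hd
  obtain ⟨⟨hd1, hd2⟩, hd3, hd4⟩ := hd
  rw [le_div_iff₀ hc0] at hd3
  rw [le_div_iff₀ hM0] at hd4
  have hseg : ∀ t ∈ Set.Icc (0 : ℝ) 1, t * ‖d ℓ‖ ≤ δ₂ := fun t ht =>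
    (mul_le_of_le_one_left (norm_nonneg _) ht.2).trans hd2
  have hcube : ∀ t ∈ Set.Icc (0 : ℝ) 1, β₂ * t * ‖d ℓ‖ ^ 3 ≤ β₂ * ‖d ℓ‖ ^ 3 := fun t ht => by
    gcongr
    exact mul_le_of_le_one_right hβ ht.2
  have hftaylor := abs_taylor_two_le_of_hess hf (x ℓ) (d ℓ) fun t ht =>
    (hrad2f ℓ t (d ℓ) ht.1 (hseg t ht)).trans (hcube t ht)
  have hgε : ∀ i, εb ≤ g i (x ℓ) := fun i => by
    simpa using hglow ℓ i 0 (by simpa using hδ₀.le)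
  have hG : ∀ i, |⟪gradient (g i) (x ℓ), d ℓ⟫| ≤ Cg * ‖d ℓ‖ := fun i =>
    (abs_real_inner_le_norm _ _).trans (by gcongr; exact hgradb ℓ i)
  have hQ : ∀ i, |⟪Hess (g i) (x ℓ) (d ℓ), d ℓ⟫| ≤ CG * ‖d ℓ‖ ^ 2 := fun i => by
    refine (abs_real_inner_le_norm _ _).trans ?_
    rw [sq, ← mul_assoc]
    gcongr
    exact (Hess (g i) (x ℓ)).le_of_opNorm_le (hhessb ℓ i) _
  have hlog := fun i => abs_log_taylor_two_le hεb (hgε i) (norm_nonneg (d ℓ)) hd1 hCg.le hCG.le hβ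
    (by linarith) (hG i) (hQ i) (abs_taylor_two_le_of_hess (hg i) (x ℓ) (d ℓ) fun t ht =>
      (hrad2g ℓ i t (d ℓ) ht.1 (hseg t ht)).trans (hcube t ht))
  have hdual : ∀ i, |1 / 2 * (⟪Hess (g i) (x ℓ) (d ℓ), d ℓ⟫
      - (g i (x ℓ))⁻¹ * ⟪gradient (g i) (x ℓ), d ℓ⟫ ^ 2)| ≤ D * ‖d ℓ‖ ^ 2 := fun i => by
    have h1 : (g i (x ℓ))⁻¹ * ⟪gradient (g i) (x ℓ), d ℓ⟫ ^ 2 ≤ εb⁻¹ * (Cg * ‖d ℓ‖) ^ 2 := by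
      rw [← sq_abs ⟪gradient (g i) (x ℓ), d ℓ⟫]
      gcongr
      exacts [hgε i, hG i]
    have h2 : 0 ≤ (g i (x ℓ))⁻¹ * ⟪gradient (g i) (x ℓ), d ℓ⟫ ^ 2 :=
      mul_nonneg (inv_nonneg.2 (hgpos ℓ i).le) (sq_nonneg _)
    have h3 := abs_le.1 (hQ i)
    have h4 : 0 ≤ εb⁻¹ * (Cg * ‖d ℓ‖) ^ 2 := by positivity
    rw [hD, abs_le]
    constructor <;> linarith
  rw [predRed_sub_aredRed_eq]
  refine (abs_add_le _ _).trans ((add_le_add (abs_sub _ _) le_rfl).trans ?_)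
  have hlogsum := (Finset.abs_sum_le_sum_abs _ _).trans
    (Finset.sum_le_sum fun i (_ : i ∈ Finset.univ) => hlog i)
  rw [Finset.sum_const, Finset.card_univ, Fintype.card_fin, nsmul_eq_mul] at hlogsum
  have hdualsum : |∑ i, (z ℓ i - μ / g i (x ℓ)) * (1 / 2 * (⟪Hess (g i) (x ℓ) (d ℓ), d ℓ⟫
      - (g i (x ℓ))⁻¹ * ⟪gradient (g i) (x ℓ), d ℓ⟫ ^ 2))| ≤ γ / 2 * ‖d ℓ‖ ^ 2 := by
    calc _ ≤ ∑ i, |z ℓ i - μ / g i (x ℓ)| * (D * ‖d ℓ‖ ^ 2) := by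
          refine (Finset.abs_sum_le_sum_abs _ _).trans (Finset.sum_le_sum fun i _ => ?_)
          rw [abs_mul]
          exact mul_le_mul_of_nonneg_left (hdual i) (abs_nonneg _)
      _ = (∑ i, |z ℓ i - μ / g i (x ℓ)|) * (D * ‖d ℓ‖ ^ 2) := by rw [Finset.sum_mul]
      _ ≤ γ / 2 / D * (D * ‖d ℓ‖ ^ 2) := by gcongr; exact hK ℓ hℓ
      _ = γ / 2 * ‖d ℓ‖ ^ 2 := by field_simp
  rw [abs_mul, abs_of_pos hμ]
  have h1 := mul_le_mul_of_nonneg_left hlogsum hμ.le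
  have h2 : ‖d ℓ‖ * M * ‖d ℓ‖ ^ 2 ≤ γ / 2 * ‖d ℓ‖ ^ 2 := by gcongr
  have h3 : ‖d ℓ‖ * M * ‖d ℓ‖ ^ 2 = β₂ * ‖d ℓ‖ ^ 3 + μ * (m * (B * ‖d ℓ‖ ^ 3)) := by
    rw [hM]; ring
  linarith

end
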